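/- Let p ≥ 3, h = 0 and β > β*(p), let m be a global maximizer of H_{β,0,p} with H''_{β,0,p}(m) < 0 and m ≠ 0, and let A be an open neighborhood of m whose closure contains no other global maximizer of H_{β,0,p}. Let X ~ P_{β,0,p}, X̄ := (Σ_{i=1}^N X_i)/N, W := √N(X̄ − m), g(t) := tanh^{−1}(t)/(p t^{p−1}), a := g'(m) (assumed nonzero), b := g''(m)/(2√N), and let Z be a centered Gaussian random variable with variance −1/H''_{β,0,p}(m). Then there exists a constant C > 0 (depending only on β and p) such that for all N ≥ 2, sup_{t ∈ ℝ} | P( aW + bW² > t | X̄ ∈ A ) − P( aZ > t ) | ≤ C (log N)/√N. -/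

import Mathlib

open Real MeasureTheory Filter
open scoped BigOperators Topology

noncomputable section

/-- The spin value (`±1`) of a Boolean coordinate. -/
def spin (b : Bool) : ℝ := if b then 1 else -1

/-- The total magnetization `S_N = ∑ᵢ Xᵢ` of a configuration. -/
def mag {N : ℕ} (x : Fin N → Bool) : ℝ := ∑ i, spin (x i)

/-- The Hamiltonian of the `p`-spin Curie-Weiss model:
`β N^{1-p} ∑_{i₁,…,i_p} x_{i₁} ⋯ x_{i_p} + h ∑ᵢ xᵢ`. -/
def cwHamiltonian (p N : ℕ) (β h : ℝ) (x : Fin N → Bool) : ℝ :=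
  β * (N : ℝ) ^ ((1 : ℤ) - (p : ℤ)) * (∑ i : Fin p → Fin N, ∏ j, spin (x (i j)))
    + h * mag x

/-- The (unnormalized) Gibbs weight of a configuration. -/
def cwWeight (p N : ℕ) (β h : ℝ) (x : Fin N → Bool) : ℝ :=
  Real.exp (cwHamiltonian p N β h x)

/-- The probability of an event `E` under the `p`-spin Curie-Weiss measure `P_{β,h,p}`. -/
def cwProb (p N : ℕ) (β h : ℝ) (E : Set (Fin N → Bool)) : ℝ :=
  (∑ x : Fin N → Bool, E.indicator (cwWeight p N β h) x) /
    ∑ x : Fin N → Bool, cwWeight p N β h x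

/-- Conditional probability of `E` given `A` under the `p`-spin Curie-Weiss measure. -/
def cwCondProb (p N : ℕ) (β h : ℝ) (E A : Set (Fin N → Bool)) : ℝ :=
  cwProb p N β h (E ∩ A) / cwProb p N β h A

/-- The binary entropy function `I(x) = ½[(1+x)log(1+x) + (1-x)log(1-x)]`. -/
def binEnt (x : ℝ) : ℝ := (1/2) * ((1+x) * Real.log (1+x) + (1-x) * Real.log (1-x))

/-- The function `H_{β,h,p}(x) = βxᵖ + hx - I(x)`. -/
def Hfun (p : ℕ) (β h : ℝ) (x : ℝ) : ℝ := β * x ^ p + h * x - binEnt x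

/-- `m` is a global maximizer of `H_{β,h,p}` on `[-1,1]`, lying in `(-1,1)`. -/
def isMaximizer (p : ℕ) (β h m : ℝ) : Prop :=
  m ∈ Set.Ioo (-1 : ℝ) 1 ∧ ∀ x ∈ Set.Icc (-1 : ℝ) 1, Hfun p β h x ≤ Hfun p β h m

/-- `m` is the unique global maximizer of `H_{β,h,p}`. -/
def isUniqueMaximizer (p : ℕ) (β h m : ℝ) : Prop :=
  isMaximizer p β h m ∧ ∀ m', isMaximizer p β h m' → m' = m

/-- `(β,h)` is a `p`-regular point with unique global maximizer `m`. -/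
def pRegular (p : ℕ) (β h m : ℝ) : Prop :=
  isUniqueMaximizer p β h m ∧ iteratedDeriv 2 (Hfun p β h) m < 0

/-- `(β,h)` is a `p`-special point with unique global maximizer `m`. -/
def pSpecial (p : ℕ) (β h m : ℝ) : Prop :=
  isUniqueMaximizer p β h m ∧ iteratedDeriv 2 (Hfun p β h) m = 0

/-- `(β,h)` is a `p`-critical point: `H_{β,h,p}` has more than one global maximizer. -/
def pCritical (p : ℕ) (β h : ℝ) : Prop :=
  ∃ m₁ m₂, m₁ ≠ m₂ ∧ isMaximizer p β h m₁ ∧ isMaximizer p β h m₂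

/-- The probability assigned to a set `S ⊆ ℝ` by the centered Gaussian with variance `v`. -/
def gaussProb (v : ℝ) (S : Set ℝ) : ℝ :=
  ∫ t in S, (Real.sqrt (2 * Real.pi * v))⁻¹ * Real.exp (-t ^ 2 / (2 * v))

/-- The CDF of the centered Gaussian with variance `v`. -/
def gaussCDF (v x : ℝ) : ℝ := gaussProb v (Set.Iic x)

/-- The standard normal CDF `Φ`. -/
def stdNormCDF (x : ℝ) : ℝ := gaussCDF 1 x

/-- The CDF of the limit law `F` at a `p`-special point, where `c = H⁽⁴⁾(m_*)`:
`dF(x) = (2/Γ(1/4)) (-c/24)^{1/4} exp(c x⁴/24) dx`. -/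
def specialCDF (c x : ℝ) : ℝ :=
  ∫ t in Set.Iic x, (2 / Real.Gamma (1/4)) * ((-c) / 24) ^ ((1:ℝ)/4) * Real.exp (c * t ^ 4 / 24)

/-- The inverse hyperbolic tangent `tanh⁻¹(t) = ½ log((1+t)/(1-t))`. -/
def arctanh (t : ℝ) : ℝ := (1/2) * Real.log ((1+t)/(1-t))

/-- The function `g(t) = tanh⁻¹(t)/(p t^{p-1})`, so that the maximum pseudolikelihood
estimate of `β` is `g(X̄)`. -/
def gMPL (p : ℕ) (t : ℝ) : ℝ := arctanh t / (p * t ^ (p - 1))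

/-- The threshold `β*(p) = inf{β ≥ 0 : sup_{x∈[0,1]} H_{β,0,p}(x) > 0}`. -/
def betaStar (p : ℕ) : ℝ := sInf {b : ℝ | 0 ≤ b ∧ ∃ x ∈ Set.Icc (0:ℝ) 1, 0 < Hfun p b 0 x}

lemma mag_eq_card {N : ℕ} (x : Fin N → Bool) :
    mag x = 2 * ((Finset.univ.filter fun i => x i = true).card : ℝ) - N := by
  have h : ∀ i, spin (x i) = 2 * (if x i = true then (1 : ℝ) else 0) - 1 := by
    intro i
    unfold spin
    split_ifs <;> norm_num
  unfold mag
  simp only [h, Finset.sum_sub_distrib, ← Finset.mul_sum, Finset.sum_boole]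
  simp

/-- Sums over configurations of a function of the magnetization reduce to binomial sums. -/
lemma sum_mag_eq_sum_choose (N : ℕ) (f : ℝ → ℝ) :
    ∑ x : Fin N → Bool, f (mag x) =
      ∑ j ∈ Finset.range (N + 1), (N.choose j : ℝ) * f (2 * j - N) := by
  have h := Finset.sum_powerset_apply_card (fun j : ℕ => f (2 * (j : ℝ) - N))
    (x := (Finset.univ : Finset (Fin N)))
  simp only [Finset.card_univ, Fintype.card_fin, nsmul_eq_mul, Finset.powerset_univ] at h
  rw [← h]
  refine Finset.sum_nbij' (fun x => Finset.univ.filter fun i => x i = true)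
    (fun s i => decide (i ∈ s)) (by simp) (by simp) ?_ ?_ ?_
  · intro x _
    ext i
    simp
  · intro s _
    ext i
    simp
  · intro x _
    rw [mag_eq_card]

lemma cwWeight_zero_eq {N : ℕ} (hN : N ≠ 0) (p : ℕ) (β : ℝ) (x : Fin N → Bool) :
    cwWeight p N β 0 x = Real.exp (N * (β * (mag x / N) ^ p)) := by
  have hN' : (N : ℝ) ≠ 0 := Nat.cast_ne_zero.mpr hN
  unfold cwWeight cwHamiltonian
  rw [← Fintype.sum_pow (fun i => spin (x i)) p, zero_mul, add_zero,
    zpow_sub₀ hN', zpow_one, zpow_natCast, div_pow]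
  change Real.exp (β * (N / N ^ p) * mag x ^ p) = _
  congr 1
  ring

/-- Conditional probabilities of magnetization events are ratios of binomial sums. -/
lemma cwCondProb_eq_div (p : ℕ) {N : ℕ} (hN : N ≠ 0) (β : ℝ) (E A : Set ℝ) :
    cwCondProb p N β 0 {σ | mag σ / N ∈ E} {σ | mag σ / N ∈ A} =
      (∑ j ∈ Finset.range (N + 1), (E ∩ A).indicator
          (fun y => (N.choose j : ℝ) * Real.exp (N * (β * y ^ p))) ((2 * j - N) / N)) /
        ∑ j ∈ Finset.range (N + 1), A.indicator
          (fun y => (N.choose j : ℝ) * Real.exp (N * (β * y ^ p))) ((2 * j - N) / N) := by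
  have key : ∀ S : Set ℝ, ∑ x : Fin N → Bool,
      Set.indicator {σ : Fin N → Bool | mag σ / N ∈ S} (cwWeight p N β 0) x =
      ∑ j ∈ Finset.range (N + 1), S.indicator
          (fun y => (N.choose j : ℝ) * Real.exp (N * (β * y ^ p))) ((2 * j - N) / N) := by
    intro S
    have := sum_mag_eq_sum_choose N
      (fun y => S.indicator (fun y => Real.exp (N * (β * y ^ p))) (y / N))
    calc _ = _ := ?_
      _ = _ := this
      _ = _ := ?_
    · refine Finset.sum_congr rfl fun x _ => ?_
      by_cases h : mag x / N ∈ S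
      · rw [Set.indicator_of_mem h, Set.indicator_of_mem (by exact h), cwWeight_zero_eq hN]
      · rw [Set.indicator_of_notMem h, Set.indicator_of_notMem (by exact h)]
    · refine Finset.sum_congr rfl fun j _ => ?_
      by_cases h : (2 * (j : ℝ) - N) / N ∈ S
      · rw [Set.indicator_of_mem h, Set.indicator_of_mem h]
      · rw [Set.indicator_of_notMem h, Set.indicator_of_notMem h, mul_zero]
  have hZ : ∑ x : Fin N → Bool, cwWeight p N β 0 x ≠ 0 :=
    (Finset.sum_pos (fun x _ => Real.exp_pos _) Finset.univ_nonempty).ne'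
  unfold cwCondProb cwProb
  rw [div_div_div_cancel_right₀ hZ, key A, ← key (E ∩ A)]
  rfl

lemma log_stirlingSeq_mem_Icc {n : ℕ} (hn : n ≠ 0) :
    Real.log (Stirling.stirlingSeq n) ∈
      Set.Icc (1 / 2 * Real.log π) (1 / 2 * Real.log π + 1 / (12 * n)) := by
  have hsq : Real.log (√π) = 1 / 2 * Real.log π := by
    rw [Real.log_sqrt pi_pos.le]; ring
  have hpi : 0 < √π := Real.sqrt_pos.mpr pi_pos
  refine ⟨hsq ▸ Real.log_le_log hpi (Stirling.sqrt_pi_le_stirlingSeq hn), ?_⟩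
  let f : ℕ → ℝ := fun k => Real.log (Stirling.stirlingSeq (n + k)) - 1 / (12 * ((n + k : ℕ) : ℝ))
  have hmono : Monotone f := by
    refine monotone_nat_of_le_succ fun k => ?_
    have h := Stirling.log_stirlingSeq_sdiff_le (n + k)
    have hpos : (0 : ℝ) < ((n + k : ℕ) : ℝ) := by
      exact_mod_cast Nat.pos_of_ne_zero (by omega)
    have e : 1 / (12 * ((n + k : ℕ) : ℝ) * (((n + k : ℕ) : ℝ) + 1)) =
        1 / (12 * ((n + k : ℕ) : ℝ)) - 1 / (12 * (((n + k : ℕ) : ℝ) + 1)) := by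
      field_simp
      ring
    rw [e] at h
    simp only [f]
    rw [← add_assoc n k 1, Nat.cast_succ (n + k)]
    linarith
  have hlim : Tendsto f atTop (𝓝 (Real.log (√π) - 0)) := by
    refine Tendsto.sub ?_ ?_
    · refine ((Real.continuousAt_log hpi.ne').tendsto.comp
        Stirling.tendsto_stirlingSeq_sqrt_pi).comp (tendsto_add_atTop_nat n) |>.congr fun k => ?_
      simp [add_comm]
    · have h1 : Tendsto (fun k : ℕ => 1 / (12 * (k : ℝ))) atTop (𝓝 0) := by
        have := (tendsto_one_div_atTop_nhds_zero_nat (𝕜 := ℝ)).const_mul (1 / 12)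
        rw [mul_zero] at this
        refine this.congr fun k => ?_
        rw [one_div_mul_one_div]
      refine (h1.comp (tendsto_add_atTop_nat n)).congr fun k => ?_
      simp [add_comm]
  have := hmono.ge_of_tendsto hlim 0
  simp only [f, add_zero, sub_zero, hsq] at this
  linarith

lemma log_factorial_eq {n : ℕ} (hn : n ≠ 0) :
    Real.log (n.factorial) = n * Real.log n - n + 1 / 2 * Real.log n + 1 / 2 * Real.log 2 +
      Real.log (Stirling.stirlingSeq n) := by
  have hn' : (n : ℝ) ≠ 0 := Nat.cast_ne_zero.mpr hn
  rw [Stirling.log_stirlingSeq_formula, Real.log_div hn' (Real.exp_ne_zero 1), Real.log_exp,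
    Real.log_mul two_ne_zero hn']
  ring

/-- Stirling's approximation of a binomial coefficient in terms of the magnetization. -/
lemma abs_log_choose_sub_le {N j : ℕ} {x : ℝ} (hj : 0 < j) (hjN : j < N)
    (hx : x = (2 * j - N) / N) :
    |Real.log (N.choose j) - (N * Real.log 2 - N * binEnt x + 1 / 2 * Real.log (2 / (π * N))
        - 1 / 2 * Real.log (1 - x ^ 2))| ≤ 1 / N * (1 / (1 - x ^ 2)) := by
  obtain ⟨l, rfl⟩ := Nat.exists_eq_add_of_le hjN.le
  have hNr : (0 : ℝ) < ((j + l : ℕ) : ℝ) := by exact_mod_cast (by omega)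
  have hjr : (0 : ℝ) < (j : ℝ) := by exact_mod_cast hj
  have hlr : (0 : ℝ) < (l : ℝ) := by exact_mod_cast (by omega)
  have h1 : 1 + x = 2 * j / ((j + l : ℕ) : ℝ) := by
    rw [hx]; field_simp; ring
  have h2 : 1 - x = 2 * l / ((j + l : ℕ) : ℝ) := by
    rw [hx]; field_simp; push_cast; ring
  have hp1 : 0 < 1 + x := h1 ▸ by positivity
  have hp2 : 0 < 1 - x := h2 ▸ by positivity
  have hlog1 : Real.log (1 + x) = Real.log 2 + Real.log j - Real.log ((j + l : ℕ) : ℝ) := by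
    rw [h1, Real.log_div (by positivity) hNr.ne', Real.log_mul two_ne_zero hjr.ne']
  have hlog2 : Real.log (1 - x) = Real.log 2 + Real.log l - Real.log ((j + l : ℕ) : ℝ) := by
    rw [h2, Real.log_div (by positivity) hNr.ne', Real.log_mul two_ne_zero hlr.ne']
  have hsq : 1 - x ^ 2 = (1 + x) * (1 - x) := by ring
  have hlog3 : Real.log (1 - x ^ 2) = Real.log (1 + x) + Real.log (1 - x) := by
    rw [hsq, Real.log_mul hp1.ne' hp2.ne']
  have hlog4 : Real.log (2 / (π * ((j + l : ℕ) : ℝ))) =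
      Real.log 2 - Real.log π - Real.log ((j + l : ℕ) : ℝ) := by
    rw [Real.log_div two_ne_zero (by positivity), Real.log_mul pi_ne_zero hNr.ne']
    ring
  have hch : Real.log ((j + l).choose j) =
      Real.log ((j + l).factorial) - Real.log (j.factorial) - Real.log (l.factorial) := by
    have h := Nat.choose_mul_factorial_mul_factorial (Nat.le_add_right j l)
    rw [Nat.add_sub_cancel_left] at h
    have h' : (((j + l).choose j : ℕ) : ℝ) * j.factorial * l.factorial = (j + l).factorial := by
      exact_mod_cast h
    have c1 : (((j + l).choose j : ℕ) : ℝ) ≠ 0 := by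
      exact_mod_cast (Nat.choose_pos (by omega)).ne'
    have c2 : ((j.factorial : ℕ) : ℝ) ≠ 0 := by exact_mod_cast j.factorial_ne_zero
    have c3 : ((l.factorial : ℕ) : ℝ) ≠ 0 := by exact_mod_cast l.factorial_ne_zero
    rw [← h', Real.log_mul (mul_ne_zero c1 c2) c3, Real.log_mul c1 c2]
    ring
  have hN0 : j + l ≠ 0 := by omega
  have hj0 : j ≠ 0 := by omega
  have hl0 : l ≠ 0 := by omega
  have e1 : ((j + l : ℕ) : ℝ) * (1 + x) = 2 * j := by rw [h1]; field_simp
  have e2 : ((j + l : ℕ) : ℝ) * (1 - x) = 2 * l := by rw [h2]; field_simp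
  have eN : ((j + l : ℕ) : ℝ) * binEnt x =
      j * Real.log (1 + x) + l * Real.log (1 - x) := by
    unfold binEnt
    linear_combination (1 / 2) * Real.log (1 + x) * e1 + (1 / 2) * Real.log (1 - x) * e2
  have main : Real.log ((j + l).choose j) - (((j + l : ℕ) : ℝ) * Real.log 2 -
      ((j + l : ℕ) : ℝ) * binEnt x + 1 / 2 * Real.log (2 / (π * ((j + l : ℕ) : ℝ)))
        - 1 / 2 * Real.log (1 - x ^ 2)) =
      Real.log (Stirling.stirlingSeq (j + l)) - Real.log (Stirling.stirlingSeq j)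
        - Real.log (Stirling.stirlingSeq l) + 1 / 2 * Real.log π := by
    rw [hch, log_factorial_eq hN0, log_factorial_eq hj0, log_factorial_eq hl0, eN, hlog3, hlog4,
      hlog1, hlog2]
    push_cast
    ring
  rw [main]
  obtain ⟨a1, a2⟩ := log_stirlingSeq_mem_Icc hN0
  obtain ⟨b1, b2⟩ := log_stirlingSeq_mem_Icc hj0
  obtain ⟨c1, c2⟩ := log_stirlingSeq_mem_Icc hl0
  have hsum : 1 / (12 * (j : ℝ)) + 1 / (12 * (l : ℝ)) =
      1 / 3 * (1 / ((j + l : ℕ) : ℝ) * (1 / (1 - x ^ 2))) := by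
    rw [hsq, h1, h2]
    push_cast
    field_simp
    ring
  have hNj : 1 / (12 * ((j + l : ℕ) : ℝ)) ≤ 1 / (12 * (j : ℝ)) := by
    apply one_div_le_one_div_of_le (by positivity)
    push_cast
    linarith
  have hpos : 0 < 1 / (12 * (l : ℝ)) := by positivity
  rw [abs_le]
  constructor <;> linarith

/-- The entropy upper bound for a single weight of the binomial distribution. -/
lemma choose_le_exp_binEnt {N j : ℕ} {x : ℝ} (hN : N ≠ 0) (hj : j ≤ N)
    (hx : x = (2 * j - N) / N) :
    (N.choose j : ℝ) ≤ Real.exp (N * Real.log 2 - N * binEnt x) := by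
  have hNr : (0 : ℝ) < N := by exact_mod_cast Nat.pos_of_ne_zero hN
  obtain ⟨l, rfl⟩ := Nat.exists_eq_add_of_le hj
  have h1 : (1 + x) / 2 = j / ((j + l : ℕ) : ℝ) := by
    rw [hx]; field_simp; ring
  have h2 : (1 - x) / 2 = l / ((j + l : ℕ) : ℝ) := by
    rw [hx]; field_simp; push_cast; ring
  have hp1 : 0 ≤ (1 + x) / 2 := h1 ▸ by positivity
  have hp2 : 0 ≤ (1 - x) / 2 := h2 ▸ by positivity
  have hb : ((j + l).choose j : ℝ) * (((1 + x) / 2) ^ j * ((1 - x) / 2) ^ l) ≤ 1 := by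
    have hs := add_pow ((1 + x) / 2) ((1 - x) / 2) (j + l)
    rw [show (1 + x) / 2 + (1 - x) / 2 = 1 by ring, one_pow] at hs
    refine le_trans (le_of_eq ?_) (le_of_le_of_eq (Finset.single_le_sum
      (f := fun m => ((1 + x) / 2) ^ m * ((1 - x) / 2) ^ (j + l - m) * ((j + l).choose m : ℝ))
      (fun m _ => by positivity) (Finset.mem_range.mpr (show j < j + l + 1 by omega))) hs.symm)
    simp only [Nat.add_sub_cancel_left]
    ring
  have hpow : ∀ (n : ℕ) (u : ℝ), 0 ≤ u → u / 2 = n / ((j + l : ℕ) : ℝ) →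
      (u / 2) ^ n = Real.exp (n * (Real.log u - Real.log 2)) := by
    intro n u hu hun
    rcases Nat.eq_zero_or_pos n with rfl | hn
    · simp
    · have : 0 < u / 2 := hun ▸ by positivity
      have hu' : 0 < u := by linarith
      rw [Real.exp_nat_mul, Real.exp_sub, Real.exp_log hu', Real.exp_log two_pos]
  rw [hpow j (1 + x) (by linarith) h1, hpow l (1 - x) (by linarith) h2, ← Real.exp_add] at hb
  have e1 : ((j + l : ℕ) : ℝ) * (1 + x) = 2 * j := by
    rw [div_eq_div_iff two_ne_zero hNr.ne'] at h1; linarith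
  have e2 : ((j + l : ℕ) : ℝ) * (1 - x) = 2 * l := by
    rw [div_eq_div_iff two_ne_zero hNr.ne'] at h2; linarith
  have eN : ((j + l : ℕ) : ℝ) * Real.log 2 - ((j + l : ℕ) : ℝ) * binEnt x =
      -(j * (Real.log (1 + x) - Real.log 2) + l * (Real.log (1 - x) - Real.log 2)) := by
    unfold binEnt
    push_cast at e1 e2 ⊢
    linear_combination -(1 / 2) * Real.log (1 + x) * e1 - (1 / 2) * Real.log (1 - x) * e2
  rw [eN, Real.exp_neg]
  rwa [le_inv_comm₀ (by exact_mod_cast Nat.choose_pos (by omega)) (Real.exp_pos _), ← one_div,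
    le_div_iff₀' (by exact_mod_cast Nat.choose_pos (by omega))]

lemma continuous_Hfun (p : ℕ) (β : ℝ) : Continuous (Hfun p β 0) := by
  have h1 : Continuous fun x : ℝ => (1 + x) * Real.log (1 + x) :=
    Real.continuous_mul_log.comp (by fun_prop : Continuous fun x : ℝ => 1 + x)
  have h2 : Continuous fun x : ℝ => (1 - x) * Real.log (1 - x) :=
    Real.continuous_mul_log.comp (by fun_prop : Continuous fun x : ℝ => 1 - x)
  unfold Hfun binEnt
  fun_prop

lemma analyticAt_Hfun (p : ℕ) (β : ℝ) {m : ℝ} (hm : m ∈ Set.Ioo (-1 : ℝ) 1) :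
    AnalyticAt ℝ (Hfun p β 0) m := by
  have a1 : AnalyticAt ℝ (fun x : ℝ => 1 + x) m := analyticAt_const.add analyticAt_id
  have a2 : AnalyticAt ℝ (fun x : ℝ => 1 - x) m := analyticAt_const.sub analyticAt_id
  have l1 := a1.log (by linarith [hm.1])
  have l2 := a2.log (by linarith [hm.2])
  have hpow : AnalyticAt ℝ (fun x : ℝ => x ^ p) m := analyticAt_id.pow p
  have := ((analyticAt_const (v := β)).mul hpow).add
    ((analyticAt_const (v := (0 : ℝ))).mul analyticAt_id) |>.sub
    ((analyticAt_const (v := (1 / 2 : ℝ))).mul ((a1.mul l1).add (a2.mul l2)))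
  exact this

lemma Hfun_neg (p : ℕ) (β x : ℝ) : Hfun p β 0 (-x) = Hfun p ((-1) ^ p * β) 0 x := by
  unfold Hfun binEnt
  rw [neg_pow]
  ring_nf

lemma exists_Hfun_one_lt (p : ℕ) (β : ℝ) :
    ∃ x ∈ Set.Icc (-1 : ℝ) 1, Hfun p β 0 1 < Hfun p β 0 x := by
  set u := Real.exp (-(2 * |β| * p + 1)) with hu
  have hu0 : 0 < u := Real.exp_pos _
  have hlogu : Real.log u = -(2 * |β| * p + 1) := Real.log_exp _
  have hu1 : u ≤ 1 := by
    rw [hu, Real.exp_le_one_iff]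
    have : 0 ≤ 2 * |β| * p := by positivity
    linarith
  refine ⟨1 - u, ⟨by linarith, by linarith⟩, ?_⟩
  have hb : 1 - p * u ≤ (1 - u) ^ p := by
    have := one_add_mul_le_pow (a := -u) (by linarith) p
    rw [← sub_eq_add_neg] at this
    linarith
  have hb' : (1 - u) ^ p ≤ 1 := pow_le_one₀ (by linarith) (by linarith)
  have hβ : -(|β| * (p * u)) ≤ β * ((1 - u) ^ p - 1) := by
    have : |β * ((1 - u) ^ p - 1)| ≤ |β| * (p * u) := by
      rw [abs_mul]
      gcongr
      rw [abs_le]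
      constructor <;> linarith
    exact (abs_le.mp this).1
  have hl2 : 0 < Real.log 2 := Real.log_pos one_lt_two
  have hlog : (2 - u) * Real.log (2 - u) ≤ (2 - u) * Real.log 2 := by
    have := Real.log_le_log (show 0 < 2 - u by linarith) (show 2 - u ≤ 2 by linarith)
    exact mul_le_mul_of_nonneg_left this (by linarith)
  unfold Hfun binEnt
  rw [show (1 : ℝ) + (1 - u) = 2 - u by ring, show (1 : ℝ) - (1 - u) = u by ring, hlogu]
  norm_num
  nlinarith [mul_pos hu0 hl2]

lemma exists_Hfun_neg_one_lt (p : ℕ) (β : ℝ) :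
    ∃ x ∈ Set.Icc (-1 : ℝ) 1, Hfun p β 0 (-1) < Hfun p β 0 x := by
  obtain ⟨x, hx, h⟩ := exists_Hfun_one_lt p ((-1) ^ p * β)
  refine ⟨-x, ⟨by linarith [hx.2], by linarith [hx.1]⟩, ?_⟩
  rwa [Hfun_neg, Hfun_neg]

/-- A point of `[-1,1]` attaining the maximum of `H` is a maximizer in the open interval. -/
lemma isMaximizer_of_le {p : ℕ} {β m x : ℝ} (hmax : isMaximizer p β 0 m)
    (hx : x ∈ Set.Icc (-1 : ℝ) 1) (hle : Hfun p β 0 m ≤ Hfun p β 0 x) :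
    isMaximizer p β 0 x := by
  have hall : ∀ y ∈ Set.Icc (-1 : ℝ) 1, Hfun p β 0 y ≤ Hfun p β 0 x :=
    fun y hy => (hmax.2 y hy).trans hle
  refine ⟨⟨lt_of_le_of_ne hx.1 ?_, lt_of_le_of_ne hx.2 ?_⟩, hall⟩
  · rintro rfl
    obtain ⟨y, hy, h⟩ := exists_Hfun_neg_one_lt p β
    exact (hall y hy).not_gt h
  · rintro rfl
    obtain ⟨y, hy, h⟩ := exists_Hfun_one_lt p β
    exact (hall y hy).not_gt h

/-- Second-order Taylor expansion of an analytic function at a critical point. -/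
lemma AnalyticAt.exists_abs_sub_quadratic_le {f : ℝ → ℝ} {m : ℝ} (hf : AnalyticAt ℝ f m)
    (hd : deriv f m = 0) :
    ∃ K > 0, ∀ᶠ x in 𝓝 m,
      |f x - f m - iteratedDeriv 2 f m / 2 * (x - m) ^ 2| ≤ K * |x - m| ^ 3 := by
  have h := hf.hasFPowerSeriesAt.isBigO_sub_partialSum_pow 3
  obtain ⟨K, hK, h⟩ := h.exists_pos
  refine ⟨K, hK, ?_⟩
  rw [Asymptotics.isBigOWith_iff] at h
  have ht : Tendsto (fun x => x - m) (𝓝 m) (𝓝 0) := by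
    have : Tendsto (fun x => x - m) (𝓝 m) (𝓝 (m - m)) :=
      (continuous_id.sub continuous_const).tendsto m
    rwa [sub_self] at this
  filter_upwards [ht.eventually h] with x hx
  simp only [FormalMultilinearSeries.partialSum, Finset.sum_range_succ, Finset.sum_range_zero,
    FormalMultilinearSeries.ofScalars_apply_eq, iteratedDeriv_zero, iteratedDeriv_one, hd,
    Real.norm_eq_abs, abs_pow, abs_abs] at hx
  convert hx using 2
  simp
  ring

lemma deriv_Hfun_eq_zero {p : ℕ} {β m : ℝ} (hmax : isMaximizer p β 0 m) :
    deriv (Hfun p β 0) m = 0 := by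
  apply IsLocalMax.deriv_eq_zero
  filter_upwards [isOpen_Ioo.mem_nhds hmax.1] with x hx
  exact hmax.2 x ⟨hx.1.le, hx.2.le⟩

/-- Global quadratic upper bound for `H` near the only maximizer in `closure A`. -/
lemma exists_Hfun_le_sub_sq {p : ℕ} {β m : ℝ} (hmax : isMaximizer p β 0 m)
    (hH'' : iteratedDeriv 2 (Hfun p β 0) m < 0) {A : Set ℝ}
    (hAuniq : ∀ x ∈ closure A, isMaximizer p β 0 x → x = m) :
    ∃ c > 0, ∀ x ∈ closure A ∩ Set.Icc (-1 : ℝ) 1,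
      Hfun p β 0 x ≤ Hfun p β 0 m - c * (x - m) ^ 2 := by
  obtain ⟨K, hK, hT⟩ := (analyticAt_Hfun p β hmax.1).exists_abs_sub_quadratic_le
    (deriv_Hfun_eq_zero hmax)
  obtain ⟨ε, hε, hT⟩ := Metric.eventually_nhds_iff.mp hT
  set d := -iteratedDeriv 2 (Hfun p β 0) m / 2 with hd
  have hd0 : 0 < d := by rw [hd]; linarith
  set δ := min ε (d / (2 * K)) with hδ
  have hδ0 : 0 < δ := lt_min hε (by positivity)
  have hnear : ∀ x, |x - m| < δ → Hfun p β 0 x ≤ Hfun p β 0 m - d / 2 * (x - m) ^ 2 := by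
    intro x hx
    have h1 := hT (show dist x m < ε by
      rw [Real.dist_eq]; exact hx.trans_le (min_le_left _ _))
    have h2 : |x - m| * K ≤ d / 2 := by
      have := (hx.trans_le (min_le_right _ _)).le
      rw [le_div_iff₀ (by positivity)] at this
      linarith
    have h3 : K * |x - m| ^ 3 ≤ d / 2 * (x - m) ^ 2 := by
      rw [← sq_abs (x - m)]
      nlinarith [mul_le_mul_of_nonneg_right h2 (sq_nonneg |x - m|)]
    have h4 := (abs_le.mp h1).2
    have h5 : iteratedDeriv 2 (Hfun p β 0) m / 2 = -d := by rw [hd]; ring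
    rw [h5] at h4
    linarith
  set S := (closure A ∩ Set.Icc (-1 : ℝ) 1) \ Metric.ball m δ with hS
  have hScomp : IsCompact S :=
    (isCompact_Icc.inter_left isClosed_closure).diff Metric.isOpen_ball
  have hfar : ∃ c > 0, ∀ x ∈ S, Hfun p β 0 x ≤ Hfun p β 0 m - c * (x - m) ^ 2 := by
    rcases S.eq_empty_or_nonempty with h | h
    · exact ⟨1, one_pos, by simp [h]⟩
    · obtain ⟨y, hy, hymax⟩ := hScomp.exists_isMaxOn h (continuous_Hfun p β).continuousOn
      have hlt : Hfun p β 0 y < Hfun p β 0 m := by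
        by_contra! hcon
        have := hAuniq y hy.1.1 (isMaximizer_of_le hmax hy.1.2 hcon)
        exact hy.2 (this ▸ Metric.mem_ball_self hδ0)
      refine ⟨(Hfun p β 0 m - Hfun p β 0 y) / 4, by linarith, fun x hx => ?_⟩
      have h1 : Hfun p β 0 x ≤ Hfun p β 0 y := hymax hx
      have h2 : (x - m) ^ 2 ≤ 4 := by
        nlinarith [hx.1.2.1, hx.1.2.2, hmax.1.1, hmax.1.2]
      nlinarith
  obtain ⟨c, hc, hfar⟩ := hfar
  refine ⟨min c (d / 2), lt_min hc (by positivity), fun x hx => ?_⟩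
  by_cases hxm : |x - m| < δ
  · nlinarith [hnear x hxm, min_le_right c (d / 2), sq_nonneg (x - m)]
  · have : x ∈ S := ⟨hx, by rwa [Metric.mem_ball, Real.dist_eq]⟩
    nlinarith [hfar x this, min_le_left c (d / 2), sq_nonneg (x - m)]

/-- A Gaussian is dominated by any power of `1 + w²`. -/
lemma exists_pow_mul_exp_neg_sq_le (n : ℕ) {c : ℝ} (hc : 0 < c) :
    ∃ K > 0, ∀ w : ℝ, (1 + w ^ 2) ^ n * Real.exp (-c * w ^ 2) ≤ K := by
  refine ⟨n.factorial / c ^ n * Real.exp c, by positivity, fun w => ?_⟩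
  have h := Real.pow_div_factorial_le_exp (c * (1 + w ^ 2)) (by positivity) n
  rw [mul_pow, div_le_iff₀ (by positivity)] at h
  have h2 : Real.exp (c * (1 + w ^ 2)) = Real.exp c * Real.exp (c * w ^ 2) := by
    rw [← Real.exp_add]; ring_nf
  rw [h2] at h
  rw [neg_mul, Real.exp_neg, ← div_eq_mul_inv, div_le_iff₀ (Real.exp_pos _), div_mul_eq_mul_div,
    div_mul_eq_mul_div, le_div_iff₀ (by positivity)]
  linarith

lemma one_add_sq_le_of_abs_sub_le_one {z s : ℝ} (h : |z - s| ≤ 1) :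
    1 + z ^ 2 ≤ 3 * (1 + s ^ 2) := by
  have h1 : (z - s) ^ 2 ≤ 1 := by rw [← sq_abs]; exact pow_le_one₀ (abs_nonneg _) h
  nlinarith [sq_nonneg (z - 2 * s)]

/-- Near a threshold `s`, within distance `κ (1 + z²)`, the weight `(1 + z²)⁻²` has small mass. -/
lemma inv_one_add_sq_sq_le {z s κ : ℝ} (h : |z - s| ≤ κ * (1 + z ^ 2)) :
    (1 + z ^ 2)⁻¹ ^ 2 ≤ κ * (1 + z ^ 2)⁻¹ +
      (Set.Icc (s - 3 * κ * (1 + s ^ 2)) (s + 3 * κ * (1 + s ^ 2))).indicator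
        (fun _ => 3 * (1 + s ^ 2)⁻¹) z := by
  have hz : 0 < 1 + z ^ 2 := by positivity
  have hκ : 0 ≤ κ := nonneg_of_mul_nonneg_left ((abs_nonneg _).trans h) hz
  have hinv1 : (1 + z ^ 2)⁻¹ ≤ 1 := inv_le_one_of_one_le₀ (by nlinarith [sq_nonneg z])
  rcases le_or_gt (|z - s|) 1 with h1 | h1
  · have h2 := one_add_sq_le_of_abs_sub_le_one h1
    have h3 := one_add_sq_le_of_abs_sub_le_one (abs_sub_comm z s ▸ h1)
    have h4 : |z - s| ≤ 3 * κ * (1 + s ^ 2) := by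
      refine h.trans ?_
      nlinarith
    rw [abs_le] at h4
    rw [Set.indicator_of_mem (Set.mem_Icc.mpr ⟨by linarith, by linarith⟩)]
    have h5 : (1 + z ^ 2)⁻¹ ≤ 3 * (1 + s ^ 2)⁻¹ := by
      rw [← div_eq_mul_inv, inv_le_comm₀ hz (by positivity), inv_div]
      linarith
    have h6 : 0 ≤ κ * (1 + z ^ 2)⁻¹ := by positivity
    nlinarith [inv_pos.mpr hz]
  · have h2 : (1 + z ^ 2)⁻¹ ≤ κ := by
      rw [inv_le_iff_one_le_mul₀ hz]
      linarith
    have h3 : 0 ≤ (Set.Icc (s - 3 * κ * (1 + s ^ 2)) (s + 3 * κ * (1 + s ^ 2))).indicator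
        (fun _ => 3 * (1 + s ^ 2)⁻¹) z := Set.indicator_nonneg (fun _ _ => by positivity) _
    nlinarith [inv_pos.mpr hz]

/-- Comparison of a Riemann-type sum of perturbed values of `φ` over a lattice with the integral
of `φ`, when membership in the lattice event and in `S` agree away from a threshold `s`. -/
lemma abs_sum_sub_setIntegral_le {φ : ℝ → ℝ} {K h κ W₀ s : ℝ} {n : ℕ} {q : ℕ → ℝ}
    {T : ℕ → Prop} [DecidablePred T] {S : Set ℝ} (hφc : Continuous φ) (hK : 0 ≤ K) (hh : 0 < h)
    (hκ : 0 ≤ κ) (hS : MeasurableSet S) (hφ0 : ∀ z, 0 ≤ φ z)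
    (hφ : ∀ z, φ z ≤ K * (1 + z ^ 2)⁻¹ ^ 2)
    (hq : ∀ j ≤ n, ∀ z ∈ Set.Ico (W₀ + j * h) (W₀ + (j + 1) * h),
      |q j - φ z| ≤ K * h * (1 + z ^ 2)⁻¹)
    (htail : ∀ z, z < W₀ ∨ W₀ + (n + 1) * h ≤ z → φ z ≤ K * h * (1 + z ^ 2)⁻¹)
    (hT : ∀ j ≤ n, ∀ z ∈ Set.Ico (W₀ + j * h) (W₀ + (j + 1) * h),
      ¬(T j ↔ z ∈ S) → |z - s| ≤ κ * (1 + z ^ 2)) :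
    |h * ∑ j ∈ Finset.range (n + 1), (if T j then q j else 0) - ∫ z in S, φ z| ≤
      K * (π * h + (π + 18) * κ) := by
  set r : ℕ → ℝ := fun j => if T j then q j else 0 with hr
  set cell : ℕ → Set ℝ := fun j => Set.Ico (W₀ + j * h) (W₀ + (j + 1) * h) with hcell
  set Q : ℝ → ℝ := fun z => ∑ j ∈ Finset.range (n + 1), (cell j).indicator (fun _ => r j) z
    with hQ
  set I : Set ℝ := Set.Icc (s - 3 * κ * (1 + s ^ 2)) (s + 3 * κ * (1 + s ^ 2)) with hI
  set G : ℝ → ℝ := fun z => K * (h + κ) * (1 + z ^ 2)⁻¹ +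
    K * I.indicator (fun _ => 3 * (1 + s ^ 2)⁻¹) z with hG
  have hψ : Integrable fun z : ℝ => (1 + z ^ 2)⁻¹ := integrable_inv_one_add_sq
  have hIint : Integrable (I.indicator fun _ => 3 * (1 + s ^ 2)⁻¹) :=
    (integrable_indicator_iff measurableSet_Icc).mpr (integrableOn_const (by simp))
  have hGint : Integrable G := (hψ.const_mul _).add (hIint.const_mul _)
  have hcellint : ∀ j, Integrable ((cell j).indicator fun _ => r j) := fun j =>
    (integrable_indicator_iff measurableSet_Ico).mpr (integrableOn_const (by simp))
  have hQint : Integrable Q := integrable_finsetSum _ fun j _ => hcellint j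
  have hφint : Integrable φ := by
    refine (hψ.const_mul K).mono' hφc.aestronglyMeasurable (Eventually.of_forall fun z => ?_)
    rw [Real.norm_eq_abs, abs_of_nonneg (hφ0 z)]
    refine (hφ z).trans ?_
    have : (1 + z ^ 2)⁻¹ ≤ 1 := inv_le_one_of_one_le₀ (by nlinarith [sq_nonneg z])
    have h0 : 0 ≤ (1 + z ^ 2)⁻¹ := by positivity
    gcongr
    nlinarith
  have hQI : ∫ z, Q z = h * ∑ j ∈ Finset.range (n + 1), r j := by
    rw [hQ, integral_finsetSum _ fun j _ => hcellint j, Finset.mul_sum]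
    refine Finset.sum_congr rfl fun j _ => ?_
    rw [integral_indicator measurableSet_Ico, setIntegral_const, Real.volume_real_Ico_of_le
      (by nlinarith)]
    simp only [smul_eq_mul]
    ring
  have hGI : ∫ z, G z ≤ K * (π * h + (π + 18) * κ) := by
    have hρ : 0 ≤ 3 * κ * (1 + s ^ 2) := by positivity
    rw [hG, integral_add (hψ.const_mul _) (hIint.const_mul _), integral_const_mul,
      integral_const_mul, integral_univ_inv_one_add_sq, integral_indicator measurableSet_Icc,
      setIntegral_const, Real.volume_real_Icc_of_le (by linarith)]
    simp only [smul_eq_mul]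
    apply le_of_eq
    field_simp
    ring
  have hpt : ∀ z, ‖Q z - S.indicator φ z‖ ≤ G z := by
    intro z
    rw [Real.norm_eq_abs]
    have hψ0 : 0 ≤ (1 + z ^ 2)⁻¹ := by positivity
    have hind : 0 ≤ I.indicator (fun _ => 3 * (1 + s ^ 2)⁻¹) z :=
      Set.indicator_nonneg (fun _ _ => by positivity) _
    have hG1 : K * h * (1 + z ^ 2)⁻¹ ≤ G z := by
      have h1 : 0 ≤ K * κ * (1 + z ^ 2)⁻¹ := by positivity
      have h2 := mul_nonneg hK hind
      simp only [hG]
      linarith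
    by_cases hz : z < W₀ ∨ W₀ + (n + 1) * h ≤ z
    · have hQ0 : Q z = 0 := by
        refine Finset.sum_eq_zero fun j hj => Set.indicator_of_notMem ?_ _
        have hjn : (j : ℝ) ≤ n := by exact_mod_cast Nat.lt_succ_iff.mp (Finset.mem_range.mp hj)
        rintro ⟨h1, h2⟩
        have hj0 : (0 : ℝ) ≤ j := Nat.cast_nonneg j
        rcases hz with hz | hz
        · nlinarith
        · nlinarith
      rw [hQ0, zero_sub, abs_neg]
      refine le_trans ?_ ((htail z hz).trans hG1)
      by_cases hzS : z ∈ S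
      · rw [Set.indicator_of_mem hzS, abs_of_nonneg (hφ0 z)]
      · rw [Set.indicator_of_notMem hzS, abs_zero]
        exact hφ0 z
    · push Not at hz
      obtain ⟨hz1, hz2⟩ := hz
      have hquo : 0 ≤ (z - W₀) / h := div_nonneg (by linarith) hh.le
      set j := ⌊(z - W₀) / h⌋₊ with hj
      have hj1 : (j : ℝ) * h ≤ z - W₀ := by
        rw [← le_div_iff₀ hh]; exact Nat.floor_le hquo
      have hj2 : z - W₀ < (j + 1) * h := by
        rw [← div_lt_iff₀ hh]; exact Nat.lt_floor_add_one _
      have hzj : z ∈ cell j := ⟨by linarith, by linarith⟩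
      have hjn : j ≤ n := by
        have : (j : ℝ) < n + 1 := by
          by_contra! hcon
          nlinarith
        exact Nat.lt_succ_iff.mp (by exact_mod_cast this)
      have hQj : Q z = r j := by
        simp only [hQ]
        rw [Finset.sum_eq_single j]
        · exact Set.indicator_of_mem hzj _
        · intro i _ hij
          refine Set.indicator_of_notMem ?_ _
          rintro ⟨h1, h2⟩
          rcases lt_or_gt_of_ne hij with hlt | hlt
          · have : (i : ℝ) + 1 ≤ j := by exact_mod_cast hlt
            nlinarith
          · have : (j : ℝ) + 1 ≤ i := by exact_mod_cast hlt
            nlinarith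
        · intro hn
          exact absurd (Finset.mem_range.mpr (Nat.lt_succ_of_le hjn)) hn
      rw [hQj]
      have hqj := hq j hjn z hzj
      by_cases hag : T j ↔ z ∈ S
      · refine le_trans ?_ (hqj.trans hG1)
        by_cases hzS : z ∈ S
        · simp [hr, hag.mpr hzS, hzS]
        · simp [hr, mt hag.mp hzS, hzS]
      · have h1 := inv_one_add_sq_sq_le (hT j hjn z hzj hag)
        have h2 := hφ z
        have h3 := mul_le_mul_of_nonneg_left h1 hK
        have h4 : |r j - S.indicator φ z| ≤ K * h * (1 + z ^ 2)⁻¹ + φ z := by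
          have h0 : 0 ≤ K * h * (1 + z ^ 2)⁻¹ := by positivity
          by_cases hzS : z ∈ S
          · have hTj : ¬ T j := fun hTj => hag ⟨fun _ => hzS, fun _ => hTj⟩
            simp only [hr, hTj, if_false, Set.indicator_of_mem hzS, zero_sub, abs_neg,
              abs_of_nonneg (hφ0 z)]
            linarith
          · have hTj : T j := by
              by_contra hTj
              exact hag ⟨fun h => absurd h hTj, fun h => absurd h hzS⟩
            simp only [hr, hTj, if_true, Set.indicator_of_notMem hzS, sub_zero]
            calc |q j| = |(q j - φ z) + φ z| := by ring_nf
              _ ≤ |q j - φ z| + |φ z| := abs_add_le _ _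
              _ ≤ _ := by rw [abs_of_nonneg (hφ0 z)]; gcongr
        simp only [hG]
        linarith
  rw [← hQI, ← integral_indicator hS, ← integral_sub hQint (hφint.indicator hS),
    ← Real.norm_eq_abs]
  exact (norm_integral_le_of_norm_le hGint (Eventually.of_forall hpt)).trans hGI

lemma abs_exp_sub_exp_le {u v b : ℝ} (hu : u ≤ b) (hv : v ≤ b) :
    |Real.exp u - Real.exp v| ≤ |u - v| * Real.exp b := by
  wlog h : v ≤ u generalizing u v
  · rw [abs_sub_comm, abs_sub_comm u v]
    exact this hv hu (le_of_not_ge h)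
  rw [abs_of_nonneg (sub_nonneg.mpr (Real.exp_le_exp.mpr h)), abs_of_nonneg (sub_nonneg.mpr h)]
  have h1 : 1 - Real.exp (v - u) ≤ u - v := by linarith [Real.add_one_le_exp (v - u)]
  have h2 : Real.exp v = Real.exp u * Real.exp (v - u) := by rw [← Real.exp_add]; ring_nf
  calc Real.exp u - Real.exp v = Real.exp u * (1 - Real.exp (v - u)) := by rw [h2]; ring
    _ ≤ Real.exp b * (u - v) := by
      gcongr
      rw [sub_nonneg, Real.exp_le_one_iff]
      linarith
    _ = _ := mul_comm _ _

/-- Logarithm of the normalization of the weights near the maximizer `m`. -/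
def logNorm (p N : ℕ) (β m : ℝ) : ℝ :=
  N * Real.log 2 + N * Hfun p β 0 m + 1 / 2 * Real.log (2 / (π * N)) - 1 / 2 * Real.log (1 - m ^ 2)

lemma exists_abs_log_weight_sub_le {p : ℕ} {β m : ℝ} (hmax : isMaximizer p β 0 m) :
    ∃ K > 0, ∀ᶠ x : ℝ in 𝓝 m, ∀ N j : ℕ, j ≤ N → N ≠ 0 → x = (2 * j - N) / N →
      |Real.log (N.choose j) + N * (β * x ^ p) - logNorm p N β m
          - N * (Hfun p β 0 x - Hfun p β 0 m)| ≤ K * (1 / N + |x - m|) := by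
  have hm2 : 0 < 1 - m ^ 2 := by nlinarith [hmax.1.1, hmax.1.2]
  have hdiff : DifferentiableAt ℝ (fun x : ℝ => Real.log (1 - x ^ 2)) m := by
    refine DifferentiableAt.log (by fun_prop) hm2.ne'
  obtain ⟨K, hK, hlog⟩ := hdiff.isBigO_sub.exists_pos
  have hcont : ContinuousAt (fun x : ℝ => 1 / (1 - x ^ 2)) m :=
    ContinuousAt.div (by fun_prop) (by fun_prop) hm2.ne'
  have hinv := hcont.eventually (gt_mem_nhds (lt_add_one (1 / (1 - m ^ 2))))
  refine ⟨(1 / (1 - m ^ 2) + 1) + K, by positivity, ?_⟩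
  filter_upwards [hlog.bound, hinv, isOpen_Ioo.mem_nhds hmax.1] with x h1 h2 hx N j hjN hN hxe
  have hNr : (0 : ℝ) < N := by exact_mod_cast Nat.pos_of_ne_zero hN
  have hj0 : 0 < j := by
    rcases Nat.eq_zero_or_pos j with rfl | h
    · have : x = -1 := by rw [hxe]; field_simp; simp
      linarith [hx.1]
    · exact h
  have hjlt : j < N := by
    refine lt_of_le_of_ne hjN ?_
    rintro rfl
    have : x = 1 := by rw [hxe]; field_simp; ring
    linarith [hx.2]
  have hS := abs_log_choose_sub_le hj0 hjlt hxe
  have e : Real.log (N.choose j) + N * (β * x ^ p) - logNorm p N β m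
          - N * (Hfun p β 0 x - Hfun p β 0 m) =
      (Real.log (N.choose j) - (N * Real.log 2 - N * binEnt x + 1 / 2 * Real.log (2 / (π * N))
        - 1 / 2 * Real.log (1 - x ^ 2))) -
        1 / 2 * (Real.log (1 - x ^ 2) - Real.log (1 - m ^ 2)) := by
    unfold logNorm
    rw [show Hfun p β 0 x = β * x ^ p + 0 * x - binEnt x from rfl]
    ring
  rw [e]
  simp only [Real.norm_eq_abs] at h1
  have h3 : 1 / (N : ℝ) * (1 / (1 - x ^ 2)) ≤ (1 / (1 - m ^ 2) + 1) * (1 / N) := by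
    rw [mul_comm]
    gcongr
  have h4 : 0 ≤ (1 / (1 - m ^ 2) + 1) * |x - m| := by positivity
  have h5 : 0 ≤ K * (1 / (N : ℝ)) := by positivity
  have h6 : 0 ≤ K * |x - m| := by positivity
  refine (abs_sub _ _).trans ?_
  rw [abs_mul, abs_of_pos (by norm_num : (0 : ℝ) < 1 / 2)]
  linarith

lemma weight_div_exp_logNorm_le {p : ℕ} {β m x : ℝ} (hm : m ∈ Set.Ioo (-1 : ℝ) 1) {N j : ℕ}
    (hjN : j ≤ N) (hN : N ≠ 0) (hx : x = (2 * j - N) / N) :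
    (N.choose j : ℝ) * Real.exp (N * (β * x ^ p)) / Real.exp (logNorm p N β m) ≤
      2 * √N * Real.exp (N * (Hfun p β 0 x - Hfun p β 0 m)) := by
  have hNr : (0 : ℝ) < N := by exact_mod_cast Nat.pos_of_ne_zero hN
  have hm2 : 0 < 1 - m ^ 2 := by nlinarith [hm.1, hm.2]
  have h1 := choose_le_exp_binEnt hN hjN hx
  have hlogm : Real.log (1 - m ^ 2) ≤ 0 := Real.log_nonpos hm2.le (by nlinarith [sq_nonneg m])
  have hsqrt : 2 * √(N : ℝ) = Real.exp (1 / 2 * Real.log (4 * N)) := by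
    rw [show (1 : ℝ) / 2 * Real.log (4 * N) = Real.log (√(4 * N)) by
      rw [Real.log_sqrt (by positivity)]; ring, Real.exp_log (by positivity),
      Real.sqrt_mul (by norm_num), show (4 : ℝ) = 2 ^ 2 by norm_num, Real.sqrt_sq (by norm_num)]
  have hlogs : -Real.log (2 / (π * N)) ≤ Real.log (4 * N) := by
    rw [← Real.log_inv, inv_div]
    apply Real.log_le_log (by positivity)
    nlinarith [Real.pi_le_four]
  rw [div_le_iff₀ (Real.exp_pos _), hsqrt, ← Real.exp_add, ← Real.exp_add]
  calc _ ≤ Real.exp (N * Real.log 2 - N * binEnt x) * Real.exp (N * (β * x ^ p)) := by gcongr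
    _ = Real.exp (N * Real.log 2 - N * binEnt x + N * (β * x ^ p)) := by rw [Real.exp_add]
    _ ≤ _ := by
      apply Real.exp_le_exp.mpr
      unfold logNorm
      rw [show Hfun p β 0 x = β * x ^ p + 0 * x - binEnt x from rfl]
      linarith

lemma abs_pow_three_le (w : ℝ) : |w| ^ 3 ≤ 3 * (1 + w ^ 2) ^ 2 := by
  rw [← sq_abs w]
  nlinarith [sq_nonneg (|w| ^ 2 - |w|), sq_nonneg (|w| ^ 2), sq_nonneg |w|]

lemma one_add_abs_le (w : ℝ) : 1 + |w| ≤ 3 * (1 + w ^ 2) ^ 2 := by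
  rw [← sq_abs w]
  nlinarith [sq_nonneg (|w| - 1), sq_nonneg (|w| ^ 2), sq_nonneg |w|]

/-- A Taylor remainder in `y` becomes an error of order `N^{-1/2}` after rescaling `w = √N y`. -/
lemma abs_sub_mul_sq_le {N u H D K₁ K₂ y w : ℝ} (hN : 1 ≤ N) (hw : w = √N * y) (hK₁ : 0 ≤ K₁)
    (hK₂ : 0 ≤ K₂) (h₂ : |u - N * H| ≤ K₂ * (1 / N + |y|))
    (h₁ : |H - D * y ^ 2| ≤ K₁ * |y| ^ 3) :
    |u - D * w ^ 2| ≤ (K₁ + K₂) * 3 / √N * (1 + w ^ 2) ^ 2 := by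
  have hNr : 0 < N := by linarith
  have hs : 1 ≤ √N := Real.one_le_sqrt.mpr hN
  have hs0 : 0 < √N := by linarith
  have hss : √N * √N = N := Real.mul_self_sqrt hNr.le
  have hw2 : w ^ 2 = N * y ^ 2 := by rw [hw, mul_pow, sq (√N), hss]
  have hyw : |y| = |w| / √N := by
    rw [hw, abs_mul, abs_of_pos hs0]; field_simp
  have hNT : N * (K₁ * |y| ^ 3) = K₁ * |w| ^ 3 / √N := by
    rw [hyw]; nth_rewrite 1 [← hss]; field_simp
  have hNinv : 1 / N ≤ 1 / √N := by
    apply one_div_le_one_div_of_le hs0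
    nlinarith
  have e : u - D * w ^ 2 = (u - N * H) + N * (H - D * y ^ 2) := by rw [hw2]; ring
  have hpoly1 := abs_pow_three_le w
  have hpoly2 := one_add_abs_le w
  calc |u - D * w ^ 2| ≤ K₂ * (1 / N + |y|) + N * (K₁ * |y| ^ 3) := by
        rw [e]
        refine (abs_add_le _ _).trans (add_le_add h₂ ?_)
        rw [abs_mul, abs_of_pos hNr]
        exact mul_le_mul_of_nonneg_left h₁ hNr.le
    _ ≤ K₂ * (1 / √N + |w| / √N) + K₁ * |w| ^ 3 / √N := by
        rw [hNT, hyw]; gcongr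
    _ = (K₂ * (1 + |w|) + K₁ * |w| ^ 3) / √N := by ring
    _ ≤ (K₂ * (3 * (1 + w ^ 2) ^ 2) + K₁ * (3 * (1 + w ^ 2) ^ 2)) / √N := by gcongr
    _ = _ := by ring

/-- Local limit estimate: the normalized weights on `A` are uniformly close to a Gaussian. -/
lemma exists_abs_weight_sub_gaussian_le {p : ℕ} {β m : ℝ} (hmax : isMaximizer p β 0 m)
    (hH'' : iteratedDeriv 2 (Hfun p β 0) m < 0) {A : Set ℝ} (hAopen : IsOpen A) (hmA : m ∈ A)
    (hAuniq : ∀ x ∈ closure A, isMaximizer p β 0 x → x = m) :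
    ∃ K > 0, ∀ N j : ℕ, j ≤ N → N ≠ 0 → ∀ x w : ℝ, x = (2 * j - N) / N → w = √N * (x - m) →
      |A.indicator (fun y => (N.choose j : ℝ) * Real.exp (N * (β * y ^ p))) x /
          Real.exp (logNorm p N β m) - Real.exp (iteratedDeriv 2 (Hfun p β 0) m / 2 * w ^ 2)| ≤
        K / √N * (1 + w ^ 2)⁻¹ ^ 2 := by
  obtain ⟨c₀, hc₀, hquad⟩ := exists_Hfun_le_sub_sq hmax hH'' hAuniq
  obtain ⟨K₁, hK₁, hT⟩ := (analyticAt_Hfun p β hmax.1).exists_abs_sub_quadratic_le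
    (deriv_Hfun_eq_zero hmax)
  obtain ⟨K₂, hK₂, hlog⟩ := exists_abs_log_weight_sub_le hmax
  set D := iteratedDeriv 2 (Hfun p β 0) m / 2 with hD
  have hD0 : D < 0 := by rw [hD]; linarith
  set c := min c₀ (-D) with hc
  have hc0 : 0 < c := lt_min hc₀ (by linarith)
  obtain ⟨K₃, hK₃, hexp⟩ := exists_pow_mul_exp_neg_sq_le 4 hc0
  obtain ⟨δ, hδ, hnear⟩ := Metric.eventually_nhds_iff.mp
    ((hT.and hlog).and (hAopen.mem_nhds hmA))
  set M₁ := (K₁ + K₂) * 3 * Real.exp (3 * K₂) with hM₁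
  set M₂ := 2 / δ ^ 2 with hM₂
  have hM₁0 : 0 < M₁ := by positivity
  have hM₂0 : 0 < M₂ := by positivity
  refine ⟨(M₁ + M₂) * K₃, by positivity, fun N j hjN hN x w hx hw => ?_⟩
  have hN1 : (1 : ℝ) ≤ N := by exact_mod_cast Nat.one_le_iff_ne_zero.mpr hN
  have hNr : (0 : ℝ) < N := by linarith
  have hs : 1 ≤ √(N : ℝ) := Real.one_le_sqrt.mpr hN1
  have hs0 : 0 < √(N : ℝ) := by linarith
  have hss : √(N : ℝ) * √(N : ℝ) = N := Real.mul_self_sqrt hNr.le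
  have hw2 : w ^ 2 = N * (x - m) ^ 2 := by rw [hw, mul_pow, sq (√(N : ℝ)), hss]
  have hj' : (j : ℝ) ≤ N := by exact_mod_cast hjN
  have hj0 : (0 : ℝ) ≤ j := Nat.cast_nonneg j
  have hxI : x ∈ Set.Icc (-1 : ℝ) 1 := by
    rw [hx]
    constructor
    · rw [le_div_iff₀ hNr]; linarith
    · rw [div_le_iff₀ hNr]; linarith
  have hv : D * w ^ 2 ≤ -c * w ^ 2 := by
    have := min_le_right c₀ (-D)
    exact mul_le_mul_of_nonneg_right (by linarith) (sq_nonneg w)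
  have hHx : x ∈ A → N * (Hfun p β 0 x - Hfun p β 0 m) ≤ -c * w ^ 2 := by
    intro hxA
    have h1 := hquad x ⟨subset_closure hxA, hxI⟩
    have h2 : c * (x - m) ^ 2 ≤ c₀ * (x - m) ^ 2 :=
      mul_le_mul_of_nonneg_right (min_le_left _ _) (sq_nonneg _)
    have h3 := mul_le_mul_of_nonneg_left
      (show Hfun p β 0 x - Hfun p β 0 m ≤ -c * (x - m) ^ 2 by linarith) hNr.le
    rw [hw2]
    linarith
  suffices hmain : |A.indicator (fun y => (N.choose j : ℝ) * Real.exp (N * (β * y ^ p))) x /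
      Real.exp (logNorm p N β m) - Real.exp (D * w ^ 2)| ≤
      (M₁ + M₂) / √N * (1 + w ^ 2) ^ 2 * Real.exp (-c * w ^ 2) by
    refine hmain.trans ?_
    have h1 := hexp w
    rw [inv_pow, ← div_eq_mul_inv, le_div_iff₀ (by positivity)]
    calc _ = (M₁ + M₂) / √N * ((1 + w ^ 2) ^ 4 * Real.exp (-c * w ^ 2)) := by ring
      _ ≤ (M₁ + M₂) / √N * K₃ := by gcongr
      _ = _ := by ring
  have hone : 1 ≤ 1 + w ^ 2 := le_add_of_nonneg_right (sq_nonneg w)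
  by_cases hxm : dist x m < δ
  · obtain ⟨⟨hTx, hlogx⟩, hxA⟩ := hnear hxm
    have hlx := hlogx N j hjN hN hx
    rw [Set.indicator_of_mem hxA]
    have hchoose : (0 : ℝ) < N.choose j := by exact_mod_cast Nat.choose_pos hjN
    set u := Real.log (N.choose j) + N * (β * x ^ p) - logNorm p N β m with hu
    have hwu : (N.choose j : ℝ) * Real.exp (N * (β * x ^ p)) / Real.exp (logNorm p N β m) =
        Real.exp u := by
      rw [hu, Real.exp_sub, Real.exp_add, Real.exp_log hchoose]
    rw [hwu]
    have hx2 : |x - m| ≤ 2 := by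
      rw [abs_le]
      constructor <;> linarith [hxI.1, hxI.2, hmax.1.1, hmax.1.2]
    have hNinv : 1 / (N : ℝ) ≤ 1 := by rw [div_le_one hNr]; exact hN1
    have hub : u ≤ 3 * K₂ + -c * w ^ 2 := by
      have h1 := (abs_le.mp hlx).2
      have h2 := hHx hxA
      have h3 : K₂ * (1 / N + |x - m|) ≤ K₂ * 3 :=
        mul_le_mul_of_nonneg_left (by linarith) hK₂.le
      linarith
    have hvb : D * w ^ 2 ≤ 3 * K₂ + -c * w ^ 2 := by linarith
    refine (abs_exp_sub_exp_le hub hvb).trans ?_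
    have huv := abs_sub_mul_sq_le hN1 hw hK₁.le hK₂.le hlx hTx
    calc _ ≤ (K₁ + K₂) * 3 / √N * (1 + w ^ 2) ^ 2 * Real.exp (3 * K₂ + -c * w ^ 2) := by gcongr
      _ = M₁ / √N * (1 + w ^ 2) ^ 2 * Real.exp (-c * w ^ 2) := by
        rw [Real.exp_add]; ring
      _ ≤ _ := by
        gcongr
        linarith
  · have hδx : δ ^ 2 ≤ (x - m) ^ 2 := by
      rw [← sq_abs (x - m)]
      rw [Real.dist_eq, not_lt] at hxm
      exact pow_le_pow_left₀ hδ.le hxm 2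
    have hsw : 2 * √(N : ℝ) ≤ (M₁ + M₂) / √N * (1 + w ^ 2) ^ 2 := by
      have h1 : N * δ ^ 2 ≤ w ^ 2 := by rw [hw2]; gcongr
      have h2 : w ^ 2 ≤ (1 + w ^ 2) ^ 2 :=
        (by linarith : w ^ 2 ≤ 1 + w ^ 2).trans (le_self_pow₀ hone two_ne_zero)
      have h3 : 2 * √(N : ℝ) = M₂ / √N * (N * δ ^ 2) := by
        rw [hM₂]; nth_rewrite 3 [← hss]; field_simp
      rw [h3]
      gcongr
      · linarith
      · linarith
    set E := Real.exp (-c * w ^ 2) with hE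
    have hE0 : 0 < E := Real.exp_pos _
    have hvE : Real.exp (D * w ^ 2) ≤ 2 * √N * E := by
      have : Real.exp (D * w ^ 2) ≤ E := Real.exp_le_exp.mpr hv
      exact this.trans (le_mul_of_one_le_left hE0.le (by linarith))
    have hwE : A.indicator (fun y => (N.choose j : ℝ) * Real.exp (N * (β * y ^ p))) x /
        Real.exp (logNorm p N β m) ≤ 2 * √N * E := by
      by_cases hxA : x ∈ A
      · rw [Set.indicator_of_mem hxA]
        refine (weight_div_exp_logNorm_le hmax.1 hjN hN hx).trans ?_
        gcongr
        exact Real.exp_le_exp.mpr (hHx hxA)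
      · rw [Set.indicator_of_notMem hxA, zero_div]
        positivity
    have hw0 : 0 ≤ A.indicator (fun y => (N.choose j : ℝ) * Real.exp (N * (β * y ^ p))) x /
        Real.exp (logNorm p N β m) :=
      div_nonneg (Set.indicator_nonneg (fun _ _ => by positivity) _) (Real.exp_pos _).le
    have hv0 := Real.exp_pos (D * w ^ 2)
    refine le_trans ?_ (mul_le_mul_of_nonneg_right hsw hE0.le)
    rw [abs_le]
    constructor <;> linarith

lemma one_add_sq_le_of_abs_sub_le_two {z w : ℝ} (h : |z - w| ≤ 2) :
    1 + z ^ 2 ≤ 9 * (1 + w ^ 2) := by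
  have h1 : (z - w) ^ 2 ≤ 4 := by
    rw [← sq_abs]; nlinarith [abs_nonneg (z - w)]
  nlinarith [sq_nonneg (z - 2 * w)]

lemma inv_one_add_sq_le_of_abs_sub_le_two {z w : ℝ} (h : |z - w| ≤ 2) :
    (1 + w ^ 2)⁻¹ ≤ 9 * (1 + z ^ 2)⁻¹ := by
  have h1 := one_add_sq_le_of_abs_sub_le_two h
  rw [← div_eq_mul_inv, inv_le_comm₀ (by positivity) (by positivity), inv_div]
  linarith

lemma exists_gaussian_le_inv_pow {D : ℝ} (hD : D < 0) (n : ℕ) :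
    ∃ K > 0, ∀ z : ℝ, Real.exp (D * z ^ 2) ≤ K * (1 + z ^ 2)⁻¹ ^ n := by
  obtain ⟨K, hK, h⟩ := exists_pow_mul_exp_neg_sq_le n (neg_pos.mpr hD)
  refine ⟨K, hK, fun z => ?_⟩
  have := h z
  rw [neg_neg] at this
  rw [inv_pow, ← div_eq_mul_inv, le_div_iff₀ (by positivity)]
  linarith

/-- Weighted Lipschitz estimate for Gaussian densities. -/
lemma exists_abs_gaussian_sub_le {D : ℝ} (hD : D < 0) :
    ∃ K > 0, ∀ h w z : ℝ, h ≤ 2 → |z - w| ≤ h →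
      |Real.exp (D * w ^ 2) - Real.exp (D * z ^ 2)| ≤ K * h * (1 + z ^ 2)⁻¹ := by
  obtain ⟨K, hK, hφ⟩ := exists_gaussian_le_inv_pow hD 2
  refine ⟨-D * 4 * (81 * K), by nlinarith, fun h w z hh hzw => ?_⟩
  have hψ0 : 0 < (1 + z ^ 2)⁻¹ := by positivity
  have hh0 : 0 ≤ h := (abs_nonneg _).trans hzw
  have hmax : Real.exp (max (D * w ^ 2) (D * z ^ 2)) ≤ 81 * K * (1 + z ^ 2)⁻¹ ^ 2 := by
    rcases max_choice (D * w ^ 2) (D * z ^ 2) with e | e <;> rw [e]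
    · calc _ ≤ K * (1 + w ^ 2)⁻¹ ^ 2 := hφ w
        _ ≤ K * (9 * (1 + z ^ 2)⁻¹) ^ 2 := by
          gcongr
          exact inv_one_add_sq_le_of_abs_sub_le_two (hzw.trans hh)
        _ = _ := by ring
    · have := hφ z
      nlinarith [mul_pos hK (pow_pos hψ0 2)]
  have hsq : |D * w ^ 2 - D * z ^ 2| ≤ -D * 4 * h * (1 + z ^ 2) := by
    have e : D * w ^ 2 - D * z ^ 2 = -D * ((z - w) * (z + w)) := by ring
    have h1 : |z + w| ≤ 4 * (1 + z ^ 2) := by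
      have h2 : |z + w| ≤ 2 * |z| + |z - w| := by
        calc |z + w| = |2 * z - (z - w)| := by ring_nf
          _ ≤ |2 * z| + |z - w| := abs_sub _ _
          _ = _ := by rw [abs_mul, abs_two]
      nlinarith [sq_nonneg (|z| - 1), sq_abs z]
    rw [e, abs_mul, abs_mul, abs_of_pos (neg_pos.mpr hD)]
    calc -D * (|z - w| * |z + w|) ≤ -D * (h * (4 * (1 + z ^ 2))) := by
          apply mul_le_mul_of_nonneg_left _ (by linarith)
          gcongr
      _ = _ := by ring
  calc _ ≤ |D * w ^ 2 - D * z ^ 2| * Real.exp (max (D * w ^ 2) (D * z ^ 2)) :=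
        abs_exp_sub_exp_le (le_max_left _ _) (le_max_right _ _)
    _ ≤ (-D * 4 * h * (1 + z ^ 2)) * (81 * K * (1 + z ^ 2)⁻¹ ^ 2) :=
        mul_le_mul hsq hmax (Real.exp_pos _).le ((abs_nonneg _).trans hsq)
    _ = _ := by field_simp

/-- Lattice sums of normalized weights over an event converge to Gaussian integrals at rate
`N^{-1/2}`, uniformly over events that agree with a half-line up to the given tolerance. -/
lemma exists_abs_lattice_sum_sub_le {p : ℕ} {β m : ℝ} (hmax : isMaximizer p β 0 m)
    (hH'' : iteratedDeriv 2 (Hfun p β 0) m < 0) {A : Set ℝ} (hAopen : IsOpen A) (hmA : m ∈ A)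
    (hAuniq : ∀ x ∈ closure A, isMaximizer p β 0 x → x = m) {κ : ℝ} (hκ : 0 ≤ κ) :
    ∃ K > 0, ∀ N : ℕ, N ≠ 0 → ∀ (E S : Set ℝ) (s : ℝ), MeasurableSet S →
      (∀ y z, |z - √N * (y - m)| ≤ 2 / √N → ¬(y ∈ E ↔ z ∈ S) →
        |z - s| ≤ κ * (2 / √N) * (1 + z ^ 2)) →
      |2 / √N * ((∑ j ∈ Finset.range (N + 1), (E ∩ A).indicator
          (fun y => (N.choose j : ℝ) * Real.exp (N * (β * y ^ p))) ((2 * j - N) / N)) /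
            Real.exp (logNorm p N β m)) -
        ∫ z in S, Real.exp (iteratedDeriv 2 (Hfun p β 0) m / 2 * z ^ 2)| ≤ K / √N := by
  classical
  obtain ⟨K₁, hK₁, hw⟩ := exists_abs_weight_sub_gaussian_le hmax hH'' hAopen hmA hAuniq
  set D := iteratedDeriv 2 (Hfun p β 0) m / 2 with hD
  have hD0 : D < 0 := by rw [hD]; linarith
  obtain ⟨K₂, hK₂, hlip⟩ := exists_abs_gaussian_sub_le hD0
  obtain ⟨K₃, hK₃, hφ⟩ := exists_gaussian_le_inv_pow hD0 2
  set η := 1 - |m| with hη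
  have hη0 : 0 < η := by
    rw [hη, sub_pos, abs_lt]; exact hmax.1
  set K := K₁ * 9 / 2 + K₂ + K₃ + K₃ / (2 * η) with hK
  have hK0 : 0 < K := by positivity
  refine ⟨K * (π + (π + 18) * κ) * 2, by positivity, fun N hN E S s hS hES => ?_⟩
  have hN1 : (1 : ℝ) ≤ N := by exact_mod_cast Nat.one_le_iff_ne_zero.mpr hN
  have hNr : (0 : ℝ) < N := by linarith
  have hs : 1 ≤ √(N : ℝ) := Real.one_le_sqrt.mpr hN1
  have hs0 : 0 < √(N : ℝ) := by linarith
  have hss : √(N : ℝ) * √(N : ℝ) = N := Real.mul_self_sqrt hNr.le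
  set h := 2 / √(N : ℝ) with hh
  have hh0 : 0 < h := by positivity
  have hh2 : h ≤ 2 := div_le_self two_pos.le hs
  set W₀ := √(N : ℝ) * (-1 - m) with hW₀
  have hNh : N * h = 2 * √(N : ℝ) := by rw [hh]; nth_rewrite 1 [← hss]; field_simp
  have hlat : ∀ j : ℕ, W₀ + j * h = √N * ((2 * j - N) / N - m) := by
    intro j
    have : (2 * (j : ℝ) - N) / N = j * (2 / N) - 1 := by field_simp
    have h2 : √(N : ℝ) * (2 / N) = h := by
      rw [hh]; nth_rewrite 2 [← hss]; field_simp
    rw [this, hW₀, ← h2]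
    ring
  set q : ℕ → ℝ := fun j => A.indicator (fun y => (N.choose j : ℝ) *
    Real.exp (N * (β * y ^ p))) ((2 * j - N) / N) / Real.exp (logNorm p N β m) with hq
  have hψ1 : ∀ z : ℝ, (1 + z ^ 2)⁻¹ ≤ 1 := fun z =>
    inv_le_one_of_one_le₀ (le_add_of_nonneg_right (sq_nonneg z))
  have hcell : ∀ j : ℕ, ∀ z ∈ Set.Ico (W₀ + j * h) (W₀ + (j + 1) * h),
      |z - (W₀ + j * h)| ≤ h := by
    rintro j z ⟨hz1, hz2⟩
    rw [abs_of_nonneg (by linarith)]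
    linarith
  have main := abs_sum_sub_setIntegral_le (φ := fun z => Real.exp (D * z ^ 2)) (K := K) (h := h)
    (κ := κ * h) (W₀ := W₀) (s := s) (n := N) (q := q)
    (T := fun j => (2 * (j : ℝ) - N) / N ∈ E) (S := S) (by fun_prop) hK0.le hh0 (by positivity) hS
    (fun z => (Real.exp_pos _).le) ?_ ?_ ?_ ?_
  · have hsum : ∑ j ∈ Finset.range (N + 1), (if (2 * (j : ℝ) - N) / N ∈ E then q j else 0) =
        (∑ j ∈ Finset.range (N + 1), (E ∩ A).indicator
          (fun y => (N.choose j : ℝ) * Real.exp (N * (β * y ^ p))) ((2 * j - N) / N)) /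
            Real.exp (logNorm p N β m) := by
      rw [Finset.sum_div]
      refine Finset.sum_congr rfl fun j _ => ?_
      rw [← Set.indicator_indicator]
      by_cases hE : (2 * (j : ℝ) - N) / N ∈ E
      · simp [hE, hq]
      · simp [hE]
    rw [hsum] at main
    refine main.trans (le_of_eq ?_)
    rw [hh]
    ring
  · intro z
    refine (hφ z).trans ?_
    gcongr
    have h1 : 0 < K₃ / (2 * η) := by positivity
    rw [hK]
    linarith
  · intro j hj z hz
    have hzW := hcell j z hz
    have h1 := hw N j hj hN _ _ rfl (hlat j)
    have h2 := hlip h _ z hh2 hzW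
    have h3 := inv_one_add_sq_le_of_abs_sub_le_two (hzW.trans hh2)
    have h4 : K₁ / √N * (1 + (W₀ + j * h) ^ 2)⁻¹ ^ 2 ≤ K₁ * 9 / 2 * h * (1 + z ^ 2)⁻¹ := by
      have h5 : (1 + (W₀ + j * h) ^ 2)⁻¹ ^ 2 ≤ 9 * (1 + z ^ 2)⁻¹ :=
        (pow_le_of_le_one (by positivity) (hψ1 _) two_ne_zero).trans h3
      calc _ ≤ K₁ / √N * (9 * (1 + z ^ 2)⁻¹) := by gcongr
        _ = _ := by rw [hh]; ring
    have h6 : 0 ≤ (K₃ + K₃ / (2 * η)) * h * (1 + z ^ 2)⁻¹ := by positivity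
    calc _ ≤ |q j - Real.exp (D * (W₀ + j * h) ^ 2)| +
          |Real.exp (D * (W₀ + j * h) ^ 2) - Real.exp (D * z ^ 2)| := abs_sub_le _ _ _
      _ ≤ K₁ * 9 / 2 * h * (1 + z ^ 2)⁻¹ + K₂ * h * (1 + z ^ 2)⁻¹ :=
          add_le_add (h1.trans h4) h2
      _ ≤ K * h * (1 + z ^ 2)⁻¹ := by
          rw [hK]
          linarith
  · intro z hz
    have hzη : η * √(N : ℝ) ≤ |z| := by
      rcases hz with hz | hz
      · have h1 : -m ≤ |m| := neg_le_abs m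
        have h2 : η * √(N : ℝ) ≤ -W₀ := by
          rw [hη, hW₀]
          nlinarith
        exact h2.trans ((neg_le_neg hz.le).trans (neg_le_abs z))
      · have h1 : m ≤ |m| := le_abs_self m
        have h2 : η * √(N : ℝ) ≤ W₀ + (N + 1) * h := by
          rw [add_mul, hNh, hη, hW₀]
          nlinarith
        exact h2.trans (hz.trans (le_abs_self z))
    have hψ : (1 + z ^ 2)⁻¹ ≤ h / (2 * η) := by
      have h1 : η * √(N : ℝ) ≤ 1 + z ^ 2 := by
        nlinarith [sq_nonneg (|z| - 1), sq_abs z]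
      have h2 : h / (2 * η) = (η * √(N : ℝ))⁻¹ := by rw [hh]; field_simp
      rw [h2]
      exact inv_anti₀ (by positivity) h1
    have h0 : 0 ≤ (K₁ * 9 / 2 + K₂ + K₃) * h * (1 + z ^ 2)⁻¹ := by positivity
    calc _ ≤ K₃ * (1 + z ^ 2)⁻¹ ^ 2 := hφ z
      _ = K₃ * (1 + z ^ 2)⁻¹ * (1 + z ^ 2)⁻¹ := by ring
      _ ≤ K₃ * (h / (2 * η)) * (1 + z ^ 2)⁻¹ := by gcongr
      _ = K₃ / (2 * η) * h * (1 + z ^ 2)⁻¹ := by ring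
      _ ≤ _ := by
        rw [hK]
        linarith
  · intro j hj z hz hne
    have hzW := hcell j z hz
    rw [hlat j] at hzW
    exact hES _ z hzW hne

lemma abs_div_sub_div_le {U V u v e : ℝ} (hU : 0 ≤ U) (hUV : U ≤ V) (hv : 0 < v)
    (h₁ : |U - u| ≤ e) (h₂ : |V - v| ≤ e) : |U / V - u / v| ≤ 2 * e / v := by
  have hV : 0 ≤ V := hU.trans hUV
  have hq0 : 0 ≤ U / V := div_nonneg hU hV
  have hq1 : U / V ≤ 1 := div_le_one_of_le₀ hUV hV
  have hqV : U / V * V = U := by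
    rcases hV.eq_or_lt with h | h
    · rw [← h]; simp only [mul_zero]; linarith
    · field_simp
  have e1 : U / V - u / v = ((U - u) - U / V * (V - v)) / v := by
    rw [mul_sub, hqV]; field_simp; ring
  rw [e1, abs_div, abs_of_pos hv]
  gcongr
  refine (abs_sub _ _).trans ?_
  have h3 : |U / V * (V - v)| ≤ |V - v| := by
    rw [abs_mul, abs_of_nonneg hq0]
    exact mul_le_of_le_one_left (abs_nonneg _) hq1
  linarith

/-- If the linear and the quadratic statistic disagree on an event, then `z` is close to the
threshold `t / a`. -/
lemma abs_sub_div_le_of_not_iff {a g t w z r : ℝ} (ha : a ≠ 0) (hr : 1 ≤ r)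
    (hzw : |z - w| ≤ 2 / r) (hne : ¬(a * w + g / (2 * r) * w ^ 2 > t ↔ a * z > t)) :
    |z - t / a| ≤ (1 + 9 * |g| / (4 * |a|)) * (2 / r) * (1 + z ^ 2) := by
  have ha0 : 0 < |a| := abs_pos.mpr ha
  have hr0 : 0 < r := by linarith
  set b := g / (2 * r) with hb
  have hdist : |a * z - t| ≤ |a * w + b * w ^ 2 - a * z| := by
    rcases le_or_gt (a * z) t with h | h
    · have : t < a * w + b * w ^ 2 := by
        by_contra! hcon
        exact hne ⟨fun h' => absurd h' hcon.not_gt, fun h' => absurd h' h.not_gt⟩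
      rw [abs_of_nonpos (by linarith), abs_of_pos (by linarith)]
      linarith
    · have : a * w + b * w ^ 2 ≤ t := by
        by_contra! hcon
        exact hne ⟨fun _ => h, fun _ => hcon⟩
      rw [abs_of_pos (by linarith), abs_of_nonpos (by linarith)]
      linarith
  have hw2 : w ^ 2 ≤ 9 * (1 + z ^ 2) := by
    have := one_add_sq_le_of_abs_sub_le_two
      (abs_sub_comm z w ▸ hzw.trans (div_le_self two_pos.le hr))
    linarith
  have h1 : |a * w + b * w ^ 2 - a * z| ≤ |a| * (2 / r) + |g| / (2 * r) * (9 * (1 + z ^ 2)) := by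
    calc _ = |b * w ^ 2 - a * (z - w)| := by ring_nf
      _ ≤ |b * w ^ 2| + |a * (z - w)| := abs_sub _ _
      _ = |g| / (2 * r) * w ^ 2 + |a| * |z - w| := by
        rw [abs_mul, abs_mul, abs_of_nonneg (sq_nonneg w), hb, abs_div,
          abs_of_pos (show 0 < 2 * r by positivity)]
      _ ≤ |g| / (2 * r) * (9 * (1 + z ^ 2)) + |a| * (2 / r) := by gcongr
      _ = _ := add_comm _ _
  have h2 : |z - t / a| = |a * z - t| / |a| := by
    rw [← abs_div]; congr 1; field_simp
  rw [h2, div_le_iff₀ ha0]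
  refine (hdist.trans h1).trans ?_
  have e : (1 + 9 * |g| / (4 * |a|)) * (2 / r) * (1 + z ^ 2) * |a| =
      |a| * (2 / r) + |g| / (2 * r) * (9 * (1 + z ^ 2)) + |a| * (2 / r) * z ^ 2 := by
    field_simp
    ring
  rw [e]
  have : 0 ≤ |a| * (2 / r) * z ^ 2 := by positivity
  linarith

lemma gaussProb_eq_div {H : ℝ} (hH : H < 0) (S : Set ℝ) :
    gaussProb (-1 / H) S =
      (∫ z in S, Real.exp (H / 2 * z ^ 2)) / ∫ z, Real.exp (H / 2 * z ^ 2) := by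
  have h1 : ∫ z : ℝ, Real.exp (H / 2 * z ^ 2) = √(2 * π * (-1 / H)) := by
    have := integral_gaussian (-(H / 2))
    rw [neg_neg] at this
    rw [this]
    congr 1
    field_simp
  have h2 : ∀ z : ℝ, -z ^ 2 / (2 * (-1 / H)) = H / 2 * z ^ 2 := fun z => by
    field_simp [hH.ne]
  simp only [gaussProb, h2]
  rw [h1, integral_const_mul, inv_mul_eq_div]

/-- **Berry–Esseen bound for the quadratic statistic `aW + bW²` (Lemma 4.2).** -/
theorem mple_quadratic_berry_esseen
    (p : ℕ) (hp : 3 ≤ p) (β m : ℝ) (hβ : betaStar p < β) (hm0 : m ≠ 0)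
    (hmax : isMaximizer p β 0 m)
    (hH'' : iteratedDeriv 2 (Hfun p β 0) m < 0)
    (ha : deriv (gMPL p) m ≠ 0)
    (A : Set ℝ) (hAopen : IsOpen A) (hmA : m ∈ A)
    (hAuniq : ∀ x ∈ closure A, isMaximizer p β 0 x → x = m) :
    ∃ C : ℝ, 0 < C ∧
      ∀ N : ℕ, 2 ≤ N → ∀ t : ℝ,
        |cwCondProb p N β 0
            {σ | deriv (gMPL p) m * (Real.sqrt N * (mag σ / N - m)) +
                iteratedDeriv 2 (gMPL p) m / (2 * Real.sqrt N) *
                  (Real.sqrt N * (mag σ / N - m)) ^ 2 > t}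
            {σ | mag σ / N ∈ A} -
          gaussProb (-1 / iteratedDeriv 2 (Hfun p β 0) m)
            {z | deriv (gMPL p) m * z > t}|
          ≤ C * Real.log N / Real.sqrt N := by
  set H := iteratedDeriv 2 (Hfun p β 0) m
  set a := deriv (gMPL p) m
  set g := iteratedDeriv 2 (gMPL p) m
  obtain ⟨K, hK, hlat⟩ := exists_abs_lattice_sum_sub_le hmax hH'' hAopen hmA hAuniq
    (κ := 1 + 9 * |g| / (4 * |a|)) (by positivity)
  set v := ∫ z, Real.exp (H / 2 * z ^ 2) with hv
  have hv0 : 0 < v := by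
    have h1 := integral_gaussian (-(H / 2))
    rw [neg_neg] at h1
    rw [hv, h1]
    exact Real.sqrt_pos.mpr (div_pos Real.pi_pos (by linarith))
  have hlog2 : 0 < Real.log 2 := Real.log_pos one_lt_two
  refine ⟨2 * K / (v * Real.log 2), by positivity, fun N hN t => ?_⟩
  have hN0 : N ≠ 0 := by omega
  have hN2 : (2 : ℝ) ≤ N := by exact_mod_cast hN
  have hr : 1 ≤ √(N : ℝ) := Real.one_le_sqrt.mpr (by linarith)
  set E : Set ℝ := {y | a * (√N * (y - m)) + g / (2 * √N) * (√N * (y - m)) ^ 2 > t}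
  set S : Set ℝ := {z | a * z > t}
  have hU := hlat N hN0 E S (t / a) (measurableSet_lt measurable_const (by fun_prop))
    fun y z hyz hne => abs_sub_div_le_of_not_iff ha hr hyz hne
  have hV := hlat N hN0 Set.univ Set.univ 0 MeasurableSet.univ
    fun y z _ hne => absurd (by simp) hne
  rw [Set.univ_inter, setIntegral_univ] at hV
  have hc : 0 < 2 / √(N : ℝ) := by positivity
  have hL := Real.exp_pos (logNorm p N β m)
  have hratio := (cwCondProb_eq_div p hN0 β E A).trans
    (div_div_div_cancel_right₀ hL.ne' _ _).symm
  rw [← mul_div_mul_left _ _ hc.ne'] at hratio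
  have hw : ∀ (j : ℕ) (y : ℝ), 0 ≤ (N.choose j : ℝ) * Real.exp (N * (β * y ^ p)) :=
    fun j y => by positivity
  have hdiff := abs_div_sub_div_le (mul_nonneg hc.le (div_nonneg (Finset.sum_nonneg fun j _ =>
    Set.indicator_nonneg (fun y _ => hw j y) _) hL.le))
    (mul_le_mul_of_nonneg_left (div_le_div_of_nonneg_right (Finset.sum_le_sum fun j _ =>
      Set.indicator_le_indicator_of_subset Set.inter_subset_right (hw j) _) hL.le) hc.le)
    hv0 hU hV
  rw [← hratio, ← gaussProb_eq_div hH''] at hdiff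
  calc _ ≤ 2 * (K / √N) / v := hdiff
    _ = 2 * K / (v * Real.log 2) * Real.log 2 / √N := by field_simp
    _ ≤ _ := by gcongr
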